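/- Let a be an integer and let g₁, g₂, g₃ be holomorphic functions on the upper half-plane ℍ. Suppose there exist complex sequences (a_j)_{j≥0} with a₀ = 1 and (b_j)_{j≥0} such that for every τ ∈ ℍ (writing q^{1/2} = e^{πiτ}, q = e^{2πiτ}) the series below converge and g₁(τ) = q^{−a/48} Σ_{j=0}^∞ a_j q^{j/2}, g₂(τ) = q^{−a/48} Σ_{j=0}^∞ (−1)^j a_j q^{j/2}, g₃(τ) = q^{a/24} Σ_{j=0}^∞ b_j q^j. Suppose moreover that for every τ ∈ ℍ: g₁(−1/τ) = g₁(τ), g₂(−1/τ) = g₃(τ), and g₃(−1/τ) = g₂(τ). Then g₁(τ) = φ₁(τ)^a, g₂(τ) = φ₂(τ)^a, and g₃(τ) = φ₃(τ)^a for all τ ∈ ℍ. -/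

import Mathlib

open Complex

/-- The complex number π. -/
noncomputable def cπ : ℂ := Real.pi

/-- The first Jacobi theta function
`ϑ₁(λ,τ) = 2 q^{1/8} sin(πλ) ∏_{j≥1} (1-q^j e^{2πiλ})(1-q^j e^{-2πiλ})(1-q^j)`, `q = e^{2πiτ}`. -/
noncomputable def JTheta1 (z τ : ℂ) : ℂ :=
  2 * exp (cπ * I * τ / 4) * sin (cπ * z) *
    ∏' n : ℕ, ((1 - exp (2 * cπ * I * τ) ^ (n + 1) * exp (2 * cπ * I * z)) *
      (1 - exp (2 * cπ * I * τ) ^ (n + 1) * exp (-(2 * cπ * I * z))) *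
      (1 - exp (2 * cπ * I * τ) ^ (n + 1)))

/-- The Dedekind eta function `η(τ) = q^{1/24} ∏_{j≥1} (1-q^j)`, `q = e^{2πiτ}`. -/
noncomputable def DEta (τ : ℂ) : ℂ :=
  exp (cπ * I * τ / 12) * ∏' n : ℕ, (1 - exp (2 * cπ * I * τ) ^ (n + 1))

/-- The theta function of level κ:
`θ_{κ,n}(λ,τ) = Σ_{j∈ℤ} exp(2πiκ(j+n/(2κ))²τ + 2πiκ(j+n/(2κ))λ)`. -/
noncomputable def ThetaKN (κ : ℕ) (n : ℤ) (z τ : ℂ) : ℂ :=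
  ∑' j : ℤ, exp (2 * cπ * I * (κ : ℂ) * ((j : ℂ) + (n : ℂ) / (2 * (κ : ℂ))) ^ 2 * τ +
    2 * cπ * I * (κ : ℂ) * ((j : ℂ) + (n : ℂ) / (2 * (κ : ℂ))) * z)

/-- The symmetrization `θ^s_{κ,n}(λ,τ) = θ_{κ,n}(λ,τ) + θ_{κ,n}(-λ,τ)`. -/
noncomputable def ThetaS (κ : ℕ) (n : ℤ) (z τ : ℂ) : ℂ :=
  ThetaKN κ n z τ + ThetaKN κ n (-z) τ

/-- `ρ(λ,τ) = ϑ₁'(λ,τ)/ϑ₁(λ,τ)` (derivative in the first argument). -/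
noncomputable def Rho (z τ : ℂ) : ℂ :=
  deriv (fun w => JTheta1 w τ) z / JTheta1 z τ

/-- `ρ'(λ,τ)`, the derivative of `ρ` in the first argument. -/
noncomputable def Rho' (z τ : ℂ) : ℂ := deriv (fun w => Rho w τ) z

/-- `u` satisfies the KZB heat equation with parameters `κ`, `p` at `(λ,τ)`:
`2πiκ ∂u/∂τ = ∂²u/∂λ² + p(p+1)ρ'(λ,τ)u`. -/
def KZB (κ p : ℕ) (u : ℂ → ℂ → ℂ) (z τ : ℂ) : Prop :=
  2 * cπ * I * (κ : ℂ) * deriv (fun t => u z t) τ =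
    iteratedDeriv 2 (fun w => u w τ) z + (p : ℂ) * ((p : ℂ) + 1) * Rho' z τ * u z τ

/-- `φ₁(τ) = η(τ)²/(η(τ/2)η(2τ))`. -/
noncomputable def Phi1 (τ : ℂ) : ℂ := DEta τ ^ 2 / (DEta (τ / 2) * DEta (2 * τ))

/-- `φ₂(τ) = η(τ/2)/η(τ)`. -/
noncomputable def Phi2 (τ : ℂ) : ℂ := DEta (τ / 2) / DEta τ

/-- `φ₃(τ) = √2 η(2τ)/η(τ)`. -/
noncomputable def Phi3 (τ : ℂ) : ℂ := (Real.sqrt 2 : ℂ) * DEta (2 * τ) / DEta τ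

/-- Euler product in the variable `x`. -/
noncomputable def EulerP (x : ℂ) : ℂ := ∏' n : ℕ, (1 - x ^ (n + 1))

lemma EulerP_zero : EulerP 0 = 1 := by
  simp [EulerP]

lemma EulerP_ne_zero {x : ℂ} (hx : ‖x‖ < 1) : EulerP x ≠ 0 := by
  have h := tprod_one_add_ne_zero_of_summable (f := fun n : ℕ => -x ^ (n + 1)) ?_ ?_
  · simpa [EulerP, sub_eq_add_neg] using h
  · intro i h0
    have h1 : x ^ (i + 1) = 1 := by linear_combination -h0
    have h2 : ‖x‖ ^ (i + 1) = 1 := by rw [← norm_pow, h1, norm_one]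
    have h3 : ‖x‖ ^ (i + 1) < 1 := pow_lt_one₀ (norm_nonneg _) hx (by omega)
    linarith
  · simpa using (summable_nat_add_iff 1).mpr (summable_geometric_of_lt_one (norm_nonneg _) hx)

lemma EulerP_continuousAt : ContinuousAt EulerP 0 :=
  (ModularForm.differentiableOn_tprod_one_sub_pow.differentiableAt
    (Metric.ball_mem_nhds 0 one_pos)).continuousAt

lemma multipliable_odd {x : ℂ} (hx : ‖x‖ < 1) :
    Multipliable fun n : ℕ => 1 - x ^ (2 * n + 1) := by
  have : Multipliable fun n : ℕ => 1 + (-x ^ (2 * n + 1)) := by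
    apply multipliable_one_add_of_summable
    have h := (summable_nat_add_iff 1).mpr (summable_geometric_of_lt_one (norm_nonneg _) hx)
    have h2 := h.comp_injective (i := fun n : ℕ => 2 * n) (fun a b hab => by simpa using hab)
    simpa [Function.comp_def] using h2
  simpa [sub_eq_add_neg] using this

lemma norm_sq_lt {x : ℂ} (hx : ‖x‖ < 1) : ‖x ^ 2‖ < 1 := by
  rw [norm_pow]; exact pow_lt_one₀ (norm_nonneg _) hx (by norm_num)

lemma EulerP_split {x : ℂ} (hx : ‖x‖ < 1) :
    EulerP x = (∏' n : ℕ, (1 - x ^ (2 * n + 1))) * EulerP (x ^ 2) := by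
  have h := tprod_even_mul_odd (f := fun n : ℕ => 1 - x ^ (n + 1)) (multipliable_odd hx) ?_
  · rw [EulerP, ← h, EulerP]
    congr 2
    ext n
    rw [← pow_mul]; ring_nf
  · have := ModularForm.multipliable_one_sub_pow (norm_sq_lt hx)
    refine this.congr fun n => ?_
    rw [← pow_mul]; ring_nf

lemma EulerP_identity {x : ℂ} (hx : ‖x‖ < 1) :
    EulerP (-x) * EulerP x * EulerP (x ^ 4) = EulerP (x ^ 2) ^ 3 := by
  have hn : ‖-x‖ < 1 := by simpa using hx
  have h1 := EulerP_split hx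
  have h2 := EulerP_split hn
  have h3 := EulerP_split (norm_sq_lt hx)
  rw [neg_sq] at h2
  rw [← pow_mul] at h3
  norm_num at h3
  have h4 : (∏' n : ℕ, (1 - (-x) ^ (2 * n + 1))) * (∏' n : ℕ, (1 - x ^ (2 * n + 1)))
      = ∏' n : ℕ, (1 - (x ^ 2) ^ (2 * n + 1)) := by
    rw [← (multipliable_odd hn).tprod_mul (multipliable_odd hx)]
    congr 1
    ext n
    rw [Odd.neg_pow ⟨n, rfl⟩]
    ring
  rw [h2, h1]
  rw [← h4] at h3
  linear_combination (-EulerP (x^2)^2) * h3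

lemma DEta_eq (τ : ℂ) : DEta τ = exp (cπ * I * τ / 12) * EulerP (exp (2 * cπ * I * τ)) := rfl

lemma DEta_eq_eta (τ : ℂ) : DEta τ = ModularForm.eta τ := by
  unfold DEta ModularForm.eta cπ
  congr 1
  · simp [Function.Periodic.qParam]; congr 1; ring
  · congr 1; ext n; rw [ModularForm.eta_q_eq_pow]

lemma DEta_ne_zero {τ : ℂ} (h : 0 < τ.im) : DEta τ ≠ 0 := by
  rw [DEta_eq_eta]; exact ModularForm.eta_ne_zero h

lemma DEta_diff {τ : ℂ} (h : 0 < τ.im) : DifferentiableAt ℂ DEta τ := by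
  rw [show DEta = ModularForm.eta from funext DEta_eq_eta]
  exact ModularForm.differentiableAt_eta_of_mem_upperHalfPlaneSet h

lemma DEta_S {τ : ℂ} (h : 0 < τ.im) :
    DEta (-1 / τ) = (sqrt I)⁻¹ * (sqrt τ * DEta τ) := by
  rw [DEta_eq_eta, DEta_eq_eta]
  simpa using ModularForm.eta_comp_eq_csqrt_I_inv h

lemma sqrt_real_mul {r : ℝ} (hr : 0 < r) {τ : ℂ} (h : τ ≠ 0) :
    sqrt ((r : ℂ) * τ) = (Real.sqrt r : ℂ) * sqrt τ := by
  have hr' : (r : ℂ) ≠ 0 := by exact_mod_cast hr.ne'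
  rw [sqrt_eq_exp (mul_ne_zero hr' h), sqrt_eq_exp h, Complex.log_ofReal_mul hr h,
    show Real.sqrt r = Real.exp (Real.log r / 2) by
      rw [← Real.log_sqrt hr.le, Real.exp_log (Real.sqrt_pos.mpr hr)]]
  push_cast
  rw [← exp_add]; ring_nf

lemma im_half {τ : ℂ} (h : 0 < τ.im) : 0 < (τ / 2).im := by
  rw [show τ / 2 = ((1/2 : ℝ) : ℂ) * τ by push_cast; ring, Complex.im_ofReal_mul]; positivity

lemma im_two {τ : ℂ} (h : 0 < τ.im) : 0 < (2 * τ).im := by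
  simp [h]

lemma ne_of_im {τ : ℂ} (h : 0 < τ.im) : τ ≠ 0 := by
  rintro rfl; simp at h

lemma im_S {τ : ℂ} (h : 0 < τ.im) : 0 < (-1 / τ).im := by
  have h1 : -1 / τ = -(τ⁻¹) := by field_simp
  rw [h1, Complex.neg_im, Complex.inv_im]
  have : 0 < Complex.normSq τ := Complex.normSq_pos.mpr (ne_of_im h)
  have : 0 < τ.im / Complex.normSq τ := by positivity
  rw [neg_div]; linarith

lemma sqrt_ne {τ : ℂ} (h : τ ≠ 0) : sqrt τ ≠ 0 := by
  rw [sqrt_eq_exp h]; exact exp_ne_zero _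

lemma Phi2_S {τ : ℂ} (h : 0 < τ.im) : Phi2 (-1 / τ) = Phi3 τ := by
  unfold Phi2 Phi3
  rw [show -1 / τ / 2 = -1 / (2 * τ) by field_simp, DEta_S h, DEta_S (im_two h),
    show (2 : ℂ) * τ = ((2 : ℝ) : ℂ) * τ by norm_num, sqrt_real_mul two_pos (ne_of_im h)]
  have h1 := sqrt_ne (ne_of_im h)
  have h2 := sqrt_ne I_ne_zero
  have h3 := DEta_ne_zero h
  field_simp

lemma Phi3_S {τ : ℂ} (h : 0 < τ.im) : Phi3 (-1 / τ) = Phi2 τ := by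
  rw [← Phi2_S (im_S h)]
  congr 1
  field_simp [ne_of_im h]

lemma Phi_prod {τ : ℂ} (h : 0 < τ.im) : Phi1 τ * (Phi2 τ * Phi3 τ) = (Real.sqrt 2 : ℂ) := by
  unfold Phi1 Phi2 Phi3
  have h1 := DEta_ne_zero h
  have h2 := DEta_ne_zero (im_two h)
  have h3 := DEta_ne_zero (im_half h)
  generalize DEta (2 * τ) = y at *
  field_simp

lemma Phi2_ne {τ : ℂ} (h : 0 < τ.im) : Phi2 τ ≠ 0 :=
  div_ne_zero (DEta_ne_zero (im_half h)) (DEta_ne_zero h)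

lemma Phi3_ne {τ : ℂ} (h : 0 < τ.im) : Phi3 τ ≠ 0 := by
  rw [← Phi2_S h]; exact Phi2_ne (im_S h)

lemma Phi1_ne {τ : ℂ} (h : 0 < τ.im) : Phi1 τ ≠ 0 :=
  div_ne_zero (pow_ne_zero _ (DEta_ne_zero h))
    (mul_ne_zero (DEta_ne_zero (im_half h)) (DEta_ne_zero (im_two h)))

lemma Phi1_S {τ : ℂ} (h : 0 < τ.im) : Phi1 (-1 / τ) = Phi1 τ := by
  have h1 := Phi_prod (im_S h)
  rw [← Phi_prod h, Phi2_S h, Phi3_S h, mul_comm (Phi3 τ)] at h1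
  exact mul_right_cancel₀ (mul_ne_zero (Phi2_ne h) (Phi3_ne h)) h1

/-- Power series part of `Phi1` in `x = q^{1/2}`. -/
noncomputable def P1 (x : ℂ) : ℂ := EulerP (x ^ 2) ^ 2 / (EulerP x * EulerP (x ^ 4))

/-- Power series part of `Phi3` in `x = q`. -/
noncomputable def P3 (x : ℂ) : ℂ := (Real.sqrt 2 : ℂ) * EulerP (x ^ 2) / EulerP x

lemma norm_u {τ : ℂ} (h : 0 < τ.im) : ‖exp (cπ * I * τ)‖ < 1 := by
  rw [Complex.norm_exp, Real.exp_lt_one_iff]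
  simp [cπ, h, Real.pi_pos]

lemma P1_neg {x : ℂ} (hx : ‖x‖ < 1) : P1 (-x) = EulerP x / EulerP (x ^ 2) := by
  unfold P1
  rw [neg_sq, show (-x) ^ 4 = x ^ 4 by ring]
  have h1 := EulerP_ne_zero hx
  have h2 := EulerP_ne_zero (norm_sq_lt hx)
  have h3 := EulerP_ne_zero (x := -x) (by simpa using hx)
  have h4 := EulerP_ne_zero (norm_sq_lt (norm_sq_lt hx))
  rw [← pow_mul] at h4
  norm_num at h4
  rw [div_eq_div_iff (mul_ne_zero h3 h4) h2]
  linear_combination -EulerP_identity hx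

lemma exps (τ : ℂ) : exp (2 * cπ * I * τ) = exp (cπ * I * τ) ^ 2 ∧
    exp (2 * cπ * I * (τ / 2)) = exp (cπ * I * τ) ∧
    exp (2 * cπ * I * (2 * τ)) = exp (cπ * I * τ) ^ 4 := by
  refine ⟨?_, ?_, ?_⟩
  · rw [← Complex.exp_nat_mul]; congr 1; push_cast; ring
  · congr 1; ring
  · rw [← Complex.exp_nat_mul]; congr 1; push_cast; ring

lemma Phi1_eq (τ : ℂ) : Phi1 τ = exp (-(cπ * I * τ / 24)) * P1 (exp (cπ * I * τ)) := by
  obtain ⟨e1, e2, e3⟩ := exps τ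
  unfold Phi1 P1
  rw [DEta_eq, DEta_eq, DEta_eq, e1, e2, e3, mul_pow, mul_mul_mul_comm, mul_div_mul_comm]
  congr 1
  rw [← Complex.exp_nat_mul, ← exp_add, ← exp_sub]; congr 1; push_cast; ring

lemma Phi2_eq {τ : ℂ} (h : 0 < τ.im) :
    Phi2 τ = exp (-(cπ * I * τ / 24)) * P1 (-exp (cπ * I * τ)) := by
  obtain ⟨e1, e2, e3⟩ := exps τ
  rw [P1_neg (norm_u h)]
  unfold Phi2
  rw [DEta_eq, DEta_eq, e1, e2, mul_div_mul_comm]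
  congr 1
  rw [← exp_sub]; congr 1; ring

lemma Phi3_eq (τ : ℂ) :
    Phi3 τ = exp (cπ * I * τ / 12) * P3 (exp (cπ * I * τ) ^ 2) := by
  obtain ⟨e1, e2, e3⟩ := exps τ
  unfold Phi3 P3
  rw [DEta_eq, DEta_eq, e1, e3, ← pow_mul, mul_left_comm, mul_div_mul_comm]
  congr 1
  rw [← exp_sub]; congr 1; ring

lemma P1_cont : ContinuousAt P1 0 := by
  have h2 : ContinuousAt (fun x : ℂ => EulerP (x ^ 2)) 0 :=
    ContinuousAt.comp' (by simpa using EulerP_continuousAt) (by fun_prop)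
  have h4 : ContinuousAt (fun x : ℂ => EulerP (x ^ 4)) 0 :=
    ContinuousAt.comp' (by simpa using EulerP_continuousAt) (by fun_prop)
  exact (h2.pow 2).div (EulerP_continuousAt.mul h4) (by simp [EulerP_zero])

lemma P3_cont : ContinuousAt P3 0 := by
  have h2 : ContinuousAt (fun x : ℂ => EulerP (x ^ 2)) 0 :=
    ContinuousAt.comp' (by simpa using EulerP_continuousAt) (by fun_prop)
  exact (continuousAt_const.mul h2).div EulerP_continuousAt (by simp [EulerP_zero])

lemma P1_zero : P1 0 = 1 := by simp [P1, EulerP_zero]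

lemma P3_zero : P3 0 ≠ 0 := by simp [P3, EulerP_zero]

lemma series_cont {c : ℕ → ℂ} {r : ℂ} (hr : r ≠ 0) (hc : Summable fun j => c j * r ^ j) :
    ContinuousAt (fun x : ℂ => ∑' j, c j * x ^ j) 0 := by
  have h : ContinuousOn (fun x : ℂ => ∑' j, c j * x ^ j) (Metric.ball 0 ‖r‖) := by
    refine continuousOn_tsum (u := fun j => ‖c j * r ^ j‖) (fun j => by fun_prop) hc.norm ?_
    intro n x hx
    have hx' : ‖x‖ ≤ ‖r‖ := by simpa using (mem_ball_zero_iff.mp hx).le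
    rw [norm_mul, norm_mul, norm_pow, norm_pow]
    gcongr
  exact h.continuousAt (Metric.ball_mem_nhds 0 (by simpa using hr))

open UpperHalfPlane ModularForm SlashInvariantForm MatrixGroups in
lemma level_one_zero (f : ℂ → ℂ) (hf : DifferentiableOn ℂ f {τ : ℂ | 0 < τ.im})
    (hT : ∀ τ : ℂ, 0 < τ.im → f (τ + 1) = f τ) (hS : ∀ τ : ℂ, 0 < τ.im → f (-1 / τ) = f τ)
    (h0 : Filter.Tendsto (fun z : ℍ => f z) atImInfty (nhds 0)) :
    ∀ τ : ℂ, 0 < τ.im → f τ = 0 := by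
  set F : ℍ → ℂ := fun z => f z with hF
  have sS : F ∣[(0 : ℤ)] ModularGroup.S = F := by
    ext z
    rw [SL_slash_apply, UpperHalfPlane.modular_S_smul]
    have := hS z z.2
    rw [show (-1 : ℂ) / (z : ℂ) = (-(z : ℂ))⁻¹ by
      rw [inv_neg, neg_div, one_div]] at this
    simpa [hF] using this
  have sT : F ∣[(0 : ℤ)] ModularGroup.T = F := by
    ext z
    rw [SL_slash_apply, UpperHalfPlane.modular_T_smul]
    have := hT z z.2
    rw [add_comm] at this
    simpa [hF] using this
  let M : ModularForm 𝒮ℒ 0 :=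
    { toFun := F
      slash_action_eq' := by
        intro A hA
        obtain ⟨A, rfl⟩ := hA
        exact slash_action_generators_SL2Z sS sT A
      holo' := by
        rw [UpperHalfPlane.mdifferentiable_iff]
        refine hf.congr fun z hz => ?_
        have hz' : 0 < z.im := hz
        simp [hF, ofComplex_apply_of_im_pos hz']
      bdd_at_cusps' := by
        intro c hc
        rw [Subgroup.IsArithmetic.isCusp_iff_isCusp_SL2Z] at hc
        rw [OnePoint.isBoundedAt_iff_forall_SL2Z hc]
        intro γ _
        rw [slash_action_generators_SL2Z sS sT]
        exact Filter.Tendsto.isBigO_one ℝ h0 }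
  obtain ⟨c, hc⟩ := ModularFormClass.levelOne_weight_zero_const M
  have hc' : ∀ z : ℍ, f z = c := fun z => congrFun hc z
  have : c = 0 := by
    refine tendsto_nhds_unique ?_ h0
    exact tendsto_const_nhds.congr fun z => (hc' z).symm
  intro τ hτ
  exact (hc' ⟨τ, hτ⟩).trans this

lemma quot_eq {c d g A P Phi : ℂ} (a : ℤ) (h1 : exp c * g = A) (h2 : Phi = exp d * P)
    (h3 : a * d = -c) : g / Phi ^ a = A / P ^ a := by
  rw [h2, ← h1, mul_zpow, ← Complex.exp_int_mul, h3, exp_neg]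
  have := exp_ne_zero c
  field_simp

lemma isOpen_uhp : IsOpen {τ : ℂ | 0 < τ.im} := isOpen_lt continuous_const Complex.continuous_im

lemma Phi1_diff : DifferentiableOn ℂ Phi1 {τ : ℂ | 0 < τ.im} := by
  intro τ h
  have h : 0 < τ.im := h
  have h1 := DEta_diff h
  have h2 : DifferentiableAt ℂ (fun z => DEta (z / 2)) τ :=
    DifferentiableAt.fun_comp' τ (DEta_diff (im_half h)) (by fun_prop)
  have h3 : DifferentiableAt ℂ (fun z => DEta (2 * z)) τ :=
    DifferentiableAt.fun_comp' τ (DEta_diff (im_two h)) (by fun_prop)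
  exact ((h1.pow 2).div (h2.mul h3)
    (mul_ne_zero (DEta_ne_zero (im_half h)) (DEta_ne_zero (im_two h)))).differentiableWithinAt

lemma Phi2_diff : DifferentiableOn ℂ Phi2 {τ : ℂ | 0 < τ.im} := by
  intro τ h
  have h : 0 < τ.im := h
  have h2 : DifferentiableAt ℂ (fun z => DEta (z / 2)) τ :=
    DifferentiableAt.fun_comp' τ (DEta_diff (im_half h)) (by fun_prop)
  exact (h2.div (DEta_diff h) (DEta_ne_zero h)).differentiableWithinAt

lemma Phi3_diff : DifferentiableOn ℂ Phi3 {τ : ℂ | 0 < τ.im} := by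
  intro τ h
  have h : 0 < τ.im := h
  have h3 : DifferentiableAt ℂ (fun z => DEta (2 * z)) τ :=
    DifferentiableAt.fun_comp' τ (DEta_diff (im_two h)) (by fun_prop)
  exact ((h3.const_mul (Real.sqrt 2 : ℂ)).div (DEta_diff h)
    (DEta_ne_zero h)).differentiableWithinAt

lemma quot_diff {g P : ℂ → ℂ} (a : ℤ) (hg : DifferentiableOn ℂ g {τ : ℂ | 0 < τ.im})
    (hP : DifferentiableOn ℂ P {τ : ℂ | 0 < τ.im}) (h0 : ∀ τ : ℂ, 0 < τ.im → P τ ≠ 0) :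
    DifferentiableOn ℂ (fun τ => g τ / P τ ^ a - 1) {τ : ℂ | 0 < τ.im} := by
  intro τ h
  exact ((hg τ h).div ((hP τ h).zpow (Or.inl (h0 τ h))) (zpow_ne_zero _ (h0 τ h))).sub
    (differentiableWithinAt_const _)

open UpperHalfPlane in
lemma u_tendsto : Filter.Tendsto (fun z : ℍ => exp (cπ * Complex.I * (z : ℂ))) atImInfty (nhds 0) := by
  refine (UpperHalfPlane.qParam_tendsto_atImInfty (h := 2) two_pos).congr fun z => ?_
  simp only [Function.Periodic.qParam, cπ]
  congr 1
  push_cast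
  ring

/-- If `g₁, g₂, g₃` are holomorphic on `ℍ` with expansions
`g₁(τ) = q^{-a/48} Σ_j a_j q^{j/2}`, `g₂(τ) = q^{-a/48} Σ_j (-1)^j a_j q^{j/2}`,
`g₃(τ) = q^{a/24} Σ_j b_j q^j` (with `a₀ = 1`, `q^{1/2} = e^{πiτ}`), and satisfy
`g₁(-1/τ) = g₁(τ)`, `g₂(-1/τ) = g₃(τ)`, `g₃(-1/τ) = g₂(τ)`, then `gᵢ = φᵢ^a`.
The expansion `g(τ) = q^{c} Σ_j c_j q^{j/2}` is stated as
`HasSum (fun j => c_j q^{j/2}) (q^{-c} g(τ))`, where `q^{-c}` is written out as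
an exponential. -/
theorem wang_lemma (a : ℤ) (g₁ g₂ g₃ : ℂ → ℂ)
    (hg₁ : DifferentiableOn ℂ g₁ {τ : ℂ | 0 < τ.im})
    (hg₂ : DifferentiableOn ℂ g₂ {τ : ℂ | 0 < τ.im})
    (hg₃ : DifferentiableOn ℂ g₃ {τ : ℂ | 0 < τ.im})
    (aseq bseq : ℕ → ℂ) (ha0 : aseq 0 = 1)
    (hs1 : ∀ τ : ℂ, 0 < τ.im →
      HasSum (fun j : ℕ => aseq j * exp (cπ * I * τ * (j : ℂ)))
        (exp (cπ * I * (a : ℂ) * τ / 24) * g₁ τ))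
    (hs2 : ∀ τ : ℂ, 0 < τ.im →
      HasSum (fun j : ℕ => (-1 : ℂ) ^ j * aseq j * exp (cπ * I * τ * (j : ℂ)))
        (exp (cπ * I * (a : ℂ) * τ / 24) * g₂ τ))
    (hs3 : ∀ τ : ℂ, 0 < τ.im →
      HasSum (fun j : ℕ => bseq j * exp (2 * cπ * I * τ * (j : ℂ)))
        (exp (-(cπ * I * (a : ℂ) * τ / 12)) * g₃ τ))
    (hmod : ∀ τ : ℂ, 0 < τ.im →
      g₁ (-1 / τ) = g₁ τ ∧ g₂ (-1 / τ) = g₃ τ ∧ g₃ (-1 / τ) = g₂ τ) :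
    ∀ τ : ℂ, 0 < τ.im → g₁ τ = Phi1 τ ^ a ∧ g₂ τ = Phi2 τ ^ a ∧ g₃ τ = Phi3 τ ^ a := by
  set A : ℂ → ℂ := fun x => ∑' j, aseq j * x ^ j with hA
  set B : ℂ → ℂ := fun x => ∑' j, bseq j * x ^ j with hB
  have hpow : ∀ (τ : ℂ) (j : ℕ), exp (cπ * I * τ * (j : ℂ)) = exp (cπ * I * τ) ^ j := by
    intro τ j
    rw [← Complex.exp_nat_mul, mul_comm]
  have e1 : ∀ τ : ℂ, 0 < τ.im →
      exp (cπ * I * (a : ℂ) * τ / 24) * g₁ τ = A (exp (cπ * I * τ)) := by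
    intro τ h
    rw [← (hs1 τ h).tsum_eq]
    simp only [hA, hpow]
  have e2 : ∀ τ : ℂ, 0 < τ.im →
      exp (cπ * I * (a : ℂ) * τ / 24) * g₂ τ = A (-exp (cπ * I * τ)) := by
    intro τ h
    rw [← (hs2 τ h).tsum_eq]
    simp only [hA, hpow]
    congr 1
    ext j
    rw [neg_pow (exp (cπ * I * τ))]
    ring
  have hpow2 : ∀ (τ : ℂ) (j : ℕ),
      exp (2 * cπ * I * τ * (j : ℂ)) = (exp (cπ * I * τ) ^ 2) ^ j := by
    intro τ j
    rw [← (exps τ).1, ← Complex.exp_nat_mul, mul_comm]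
  have e3 : ∀ τ : ℂ, 0 < τ.im →
      exp (-(cπ * I * (a : ℂ) * τ / 12)) * g₃ τ = B (exp (cπ * I * τ) ^ 2) := by
    intro τ h
    rw [← (hs3 τ h).tsum_eq]
    simp only [hB, hpow2]
  have hI : 0 < I.im := by simp
  have cA : ContinuousAt A 0 := by
    refine series_cont (exp_ne_zero (cπ * I * I)) ?_
    simpa only [hpow] using (hs1 I hI).summable
  have cB : ContinuousAt B 0 := by
    refine series_cont (pow_ne_zero 2 (exp_ne_zero (cπ * I * I))) ?_
    simpa only [hpow2] using (hs3 I hI).summable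
  have A0 : A 0 = 1 := by
    simp only [hA]
    rw [tsum_eq_single 0 (fun j hj => by simp [hj])]
    simp [ha0]
  set W : ℂ → ℂ := fun x => A x / P1 x ^ a - 1 with hW
  set V : ℂ → ℂ := fun x => B x / P3 x ^ a - 1 with hV
  have cW : ContinuousAt W 0 :=
    (cA.div (P1_cont.zpow₀ a (Or.inl (by simp [P1_zero]))) (by simp [P1_zero])).sub
      continuousAt_const
  have cV : ContinuousAt V 0 :=
    (cB.div (P3_cont.zpow₀ a (Or.inl P3_zero)) (zpow_ne_zero _ P3_zero)).sub
      continuousAt_const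
  have W0 : W 0 = 0 := by simp [hW, A0, P1_zero]
  set h₁ : ℂ → ℂ := fun τ => g₁ τ / Phi1 τ ^ a - 1 with hh1
  set h₂ : ℂ → ℂ := fun τ => g₂ τ / Phi2 τ ^ a - 1 with hh2
  set h₃ : ℂ → ℂ := fun τ => g₃ τ / Phi3 τ ^ a - 1 with hh3
  have f1 : ∀ τ : ℂ, 0 < τ.im → h₁ τ = W (exp (cπ * I * τ)) := by
    intro τ h
    simp only [hh1, hW]
    rw [quot_eq a (e1 τ h) (Phi1_eq τ) (by ring)]
  have f2 : ∀ τ : ℂ, 0 < τ.im → h₂ τ = W (-exp (cπ * I * τ)) := by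
    intro τ h
    simp only [hh2, hW]
    rw [quot_eq a (e2 τ h) (Phi2_eq h) (by ring)]
  have f3 : ∀ τ : ℂ, 0 < τ.im → h₃ τ = V (exp (cπ * I * τ) ^ 2) := by
    intro τ h
    simp only [hh3, hV]
    rw [quot_eq a (e3 τ h) (Phi3_eq τ) (by ring)]
  have imT : ∀ τ : ℂ, 0 < τ.im → 0 < (τ + 1).im := by
    intro τ h
    simpa using h
  have uT : ∀ τ : ℂ, exp (cπ * I * (τ + 1)) = -exp (cπ * I * τ) := by
    intro τ
    rw [mul_add, mul_one, exp_add]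
    simp [cπ, Complex.exp_pi_mul_I]
  have t1 : ∀ τ : ℂ, 0 < τ.im → h₁ (τ + 1) = h₂ τ := by
    intro τ h
    rw [f1 _ (imT τ h), f2 τ h, uT]
  have t2 : ∀ τ : ℂ, 0 < τ.im → h₂ (τ + 1) = h₁ τ := by
    intro τ h
    rw [f2 _ (imT τ h), f1 τ h, uT, neg_neg]
  have t3 : ∀ τ : ℂ, 0 < τ.im → h₃ (τ + 1) = h₃ τ := by
    intro τ h
    rw [f3 _ (imT τ h), f3 τ h, uT, neg_sq]
  have s1 : ∀ τ : ℂ, 0 < τ.im → h₁ (-1 / τ) = h₁ τ := by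
    intro τ h
    simp only [hh1]
    rw [(hmod τ h).1, Phi1_S h]
  have s2 : ∀ τ : ℂ, 0 < τ.im → h₂ (-1 / τ) = h₃ τ := by
    intro τ h
    simp only [hh2, hh3]
    rw [(hmod τ h).2.1, Phi2_S h]
  have s3 : ∀ τ : ℂ, 0 < τ.im → h₃ (-1 / τ) = h₂ τ := by
    intro τ h
    simp only [hh2, hh3]
    rw [(hmod τ h).2.2, Phi3_S h]
  have d1 : DifferentiableOn ℂ h₁ {τ : ℂ | 0 < τ.im} :=
    quot_diff a hg₁ Phi1_diff fun _ h => Phi1_ne h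
  have d2 : DifferentiableOn ℂ h₂ {τ : ℂ | 0 < τ.im} :=
    quot_diff a hg₂ Phi2_diff fun _ h => Phi2_ne h
  have d3 : DifferentiableOn ℂ h₃ {τ : ℂ | 0 < τ.im} :=
    quot_diff a hg₃ Phi3_diff fun _ h => Phi3_ne h
  have hzero : ∀ τ : ℂ, 0 < τ.im → h₁ τ * (h₂ τ * h₃ τ) = 0 := by
    refine level_one_zero (fun τ => h₁ τ * (h₂ τ * h₃ τ)) (d1.mul (d2.mul d3)) ?_ ?_ ?_
    · intro τ h
      simp only [t1 τ h, t2 τ h, t3 τ h]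
      ring
    · intro τ h
      simp only [s1 τ h, s2 τ h, s3 τ h]
      ring
    · have l1 := cW.tendsto.comp u_tendsto
      have un : Filter.Tendsto (fun z : UpperHalfPlane => -exp (cπ * I * (z : ℂ)))
          UpperHalfPlane.atImInfty (nhds 0) := by simpa using u_tendsto.neg
      have us : Filter.Tendsto (fun z : UpperHalfPlane => exp (cπ * I * (z : ℂ)) ^ 2)
          UpperHalfPlane.atImInfty (nhds 0) := by simpa using u_tendsto.pow 2
      have l2 := cW.tendsto.comp un
      have l3 := cV.tendsto.comp us
      have l := l1.mul (l2.mul l3)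
      rw [W0, zero_mul] at l
      refine l.congr fun z => ?_
      simp only [Function.comp]
      rw [f1 z z.2, f2 z z.2, f3 z z.2]
  have hpre : IsPreconnected {τ : ℂ | 0 < τ.im} :=
    Convex.isPreconnected (convex_halfSpace_im_gt 0)
  have a1 := d1.analyticOnNhd isOpen_uhp
  have a2 := d2.analyticOnNhd isOpen_uhp
  have a3 := d3.analyticOnNhd isOpen_uhp
  have imT' : ∀ τ : ℂ, 0 < τ.im → 0 < (τ - 1).im := by
    intro τ h
    simpa using h
  -- once `h₂` vanishes, so do the others
  have key : (∀ τ : ℂ, 0 < τ.im → h₂ τ = 0) → ∀ τ : ℂ, 0 < τ.im →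
      h₁ τ = 0 ∧ h₂ τ = 0 ∧ h₃ τ = 0 := by
    intro hz τ h
    exact ⟨by rw [← t2 τ h]; exact hz _ (imT τ h), hz τ h,
      by rw [← s2 τ h]; exact hz _ (im_S h)⟩
  have hall : ∀ τ : ℂ, 0 < τ.im → h₁ τ = 0 ∧ h₂ τ = 0 ∧ h₃ τ = 0 := by
    apply key
    rcases AnalyticOnNhd.eq_zero_or_eq_zero_of_mul_eq_zero a1 (a2.mul a3)
      (fun τ h => hzero τ h) hpre with hz | hz
    · intro τ h
      rw [← t1 τ h]
      exact hz _ (imT τ h)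
    rcases AnalyticOnNhd.eq_zero_or_eq_zero_of_mul_eq_zero a2 a3
      (fun τ h => hz τ h) hpre with hz | hz
    · exact fun τ h => hz τ h
    · intro τ h
      rw [← s3 τ h]
      exact hz _ (im_S h)
  intro τ h
  obtain ⟨z1, z2, z3⟩ := hall τ h
  exact ⟨(div_eq_one_iff_eq (zpow_ne_zero _ (Phi1_ne h))).mp (sub_eq_zero.mp z1),
    (div_eq_one_iff_eq (zpow_ne_zero _ (Phi2_ne h))).mp (sub_eq_zero.mp z2),
    (div_eq_one_iff_eq (zpow_ne_zero _ (Phi3_ne h))).mp (sub_eq_zero.mp z3)⟩
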